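/- Assume the spectral radius of A_Q is strictly less than 1. Let λ_* ∈ {μ, L} satisfy √(λ_*)/r_{λ_*} = max(√μ/r_μ, √L/r_L), let u_* ∈ ℝ^d be a unit-norm eigenvector of Q for the eigenvalue λ_*, and define ω_* := arccos(−b_{λ_*}(1+c_{λ_*})/(4c_{λ_*})) if c_{λ_*} > 0 and |b_{λ_*}(1+c_{λ_*})| < 4|c_{λ_*}|; ω_* := π if (c_{λ_*} ≤ 0 or |b_{λ_*}(1+c_{λ_*})| ≥ 4|c_{λ_*}|) and (1 − b_{λ_*} + c_{λ_*})² ≤ (1 + b_{λ_*} + c_{λ_*})²; and ω_* := 0 otherwise. For h ∈ (0,1) set w_k^{(h)} := √(h(2−h))·(1−h)^k·cos(ω_*·k)·u_* for k ≥ 0, and let (x_k^{(h)}) be the inexact GMM iterates with errors (w_k^{(h)}) started at x₀ = x_{−1} = x_*. Then for every h ∈ (0,1) one has 0 < Σ_{k≥0} ‖w_k^{(h)}‖² < ∞ and Σ_{k≥0} (f(x_k^{(h)}) − f_*) < ∞, and √(Σ_{k≥0}(f(x_k^{(h)}) − f_*)) / √(Σ_{k≥0}‖w_k^{(h)}‖²)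 → (α/√2)·max(√μ/r_μ, √L/r_L) as h → 0⁺. -/

import Mathlib

open Matrix

/-- `b_λ := αλ(1+ν) − (1+β)`. -/
noncomputable def bCoef (α β ν lam : ℝ) : ℝ := α * lam * (1 + ν) - (1 + β)

/-- `c_λ := β − αλν`. -/
noncomputable def cCoef (α β ν lam : ℝ) : ℝ := β - α * lam * ν

/-- `r_λ` as in Theorem `thm-h-inf`. -/
noncomputable def rCoef (α β ν lam : ℝ) : ℝ :=
  if 0 < cCoef α β ν lam ∧
      |bCoef α β ν lam| * (1 + cCoef α β ν lam) / (4 * cCoef α β ν lam) < 1 then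
    |1 - cCoef α β ν lam| * Real.sqrt (1 - (bCoef α β ν lam) ^ 2 / (4 * cCoef α β ν lam))
  else
    |(|1 + cCoef α β ν lam| - |bCoef α β ν lam|)|

/-- The worst-case frequency `ω_*` for the eigenvalue `λ_*`. -/
noncomputable def omegaStar (α β ν lamstar : ℝ) : ℝ :=
  if 0 < cCoef α β ν lamstar ∧
      |bCoef α β ν lamstar * (1 + cCoef α β ν lamstar)| < 4 * |cCoef α β ν lamstar| then
    Real.arccos (-(bCoef α β ν lamstar * (1 + cCoef α β ν lamstar)) /
      (4 * cCoef α β ν lamstar))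
  else if (cCoef α β ν lamstar ≤ 0 ∨
        4 * |cCoef α β ν lamstar| ≤ |bCoef α β ν lamstar * (1 + cCoef α β ν lamstar)|) ∧
      (1 - bCoef α β ν lamstar + cCoef α β ν lamstar) ^ 2 ≤
        (1 + bCoef α β ν lamstar + cCoef α β ν lamstar) ^ 2 then
    Real.pi
  else 0

/-- The GMM iteration matrix `A_Q` (real, `2d × 2d`). -/
noncomputable def AQmat {d : ℕ} (α β ν : ℝ) (Q : Matrix (Fin d) (Fin d) ℝ) :
    Matrix (Fin d ⊕ Fin d) (Fin d ⊕ Fin d) ℝ :=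
  Matrix.fromBlocks ((1 + β) • (1 : Matrix (Fin d) (Fin d) ℝ) - (α * (1 + ν)) • Q)
    ((-β) • (1 : Matrix (Fin d) (Fin d) ℝ) + (α * ν) • Q) 1 0


lemma first_order_bound (z : ℂ) (hz : ‖z‖ < 1) (q g : ℕ → ℂ)
    (hq : ∀ k, q (k + 1) = z * q k + g k) (hg : Summable (fun k => ‖g k‖ ^ 2)) :
    Summable (fun k => ‖q k‖ ^ 2) ∧
    ∑' k, ‖q k‖ ^ 2 ≤ (1 / (1 - ‖z‖)) ^ 2 * (‖q 0‖ ^ 2 + ∑' k, ‖g k‖ ^ 2) := by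
  set t := ‖z‖ with ht
  have ht0 : 0 ≤ t := norm_nonneg _
  have h1t : 0 < 1 - t := by linarith
  have step : ∀ k, ‖q (k + 1)‖ ^ 2 ≤ t * ‖q k‖ ^ 2 + ‖g k‖ ^ 2 / (1 - t) := by
    intro k
    have h1 : ‖q (k + 1)‖ ≤ t * ‖q k‖ + ‖g k‖ := by
      rw [hq, ht, ← norm_mul]; exact norm_add_le _ _
    have h2 : ‖q (k + 1)‖ ^ 2 ≤ (t * ‖q k‖ + ‖g k‖) ^ 2 :=
      pow_le_pow_left₀ (norm_nonneg _) h1 2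
    refine h2.trans ?_
    have : t * ‖q k‖ ^ 2 + ‖g k‖ ^ 2 / (1 - t) - (t * ‖q k‖ + ‖g k‖) ^ 2
        = t * ((1 - t) * ‖q k‖ - ‖g k‖) ^ 2 / (1 - t) := by
      field_simp; ring
    have h3 : 0 ≤ t * ((1 - t) * ‖q k‖ - ‖g k‖) ^ 2 / (1 - t) := by positivity
    linarith
  set G := ∑' k, ‖g k‖ ^ 2 with hG
  have hG0 : 0 ≤ G := tsum_nonneg fun _ => by positivity
  have bound : ∀ n, ∑ k ∈ Finset.range n, ‖q k‖ ^ 2 ≤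
      (1 / (1 - t)) ^ 2 * (‖q 0‖ ^ 2 + G) := by
    intro n
    have e1 : ∑ k ∈ Finset.range n, ‖q k‖ ^ 2 ≤ ∑ k ∈ Finset.range (n + 1), ‖q k‖ ^ 2 := by
      rw [Finset.sum_range_succ]; linarith [sq_nonneg ‖q n‖]
    have e2 : ∑ k ∈ Finset.range (n + 1), ‖q k‖ ^ 2 ≤
        t * ∑ k ∈ Finset.range n, ‖q k‖ ^ 2 + G / (1 - t) + ‖q 0‖ ^ 2 := by
      rw [Finset.sum_range_succ']
      have : ∑ k ∈ Finset.range n, ‖q (k + 1)‖ ^ 2 ≤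
          ∑ k ∈ Finset.range n, (t * ‖q k‖ ^ 2 + ‖g k‖ ^ 2 / (1 - t)) :=
        Finset.sum_le_sum fun k _ => step k
      rw [Finset.sum_add_distrib, ← Finset.mul_sum, ← Finset.sum_div] at this
      have h4 : ∑ k ∈ Finset.range n, ‖g k‖ ^ 2 ≤ G :=
        hg.sum_le_tsum _ fun _ _ => by positivity
      have h5 : (∑ k ∈ Finset.range n, ‖g k‖ ^ 2) / (1 - t) ≤ G / (1 - t) := by gcongr
      linarith
    have e3 : (1 - t) * ∑ k ∈ Finset.range n, ‖q k‖ ^ 2 ≤ G / (1 - t) + ‖q 0‖ ^ 2 := by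
      linarith
    have e4 : ‖q 0‖ ^ 2 ≤ ‖q 0‖ ^ 2 / (1 - t) := by
      rw [le_div_iff₀ h1t]; nlinarith [sq_nonneg ‖q 0‖]
    have e5 : (1 / (1 - t)) ^ 2 * (‖q 0‖ ^ 2 + G) =
        (G / (1 - t) + ‖q 0‖ ^ 2 / (1 - t)) / (1 - t) := by field_simp; ring
    rw [e5, le_div_iff₀ h1t]
    linarith
  have hs := summable_of_sum_range_le (fun k => sq_nonneg ‖q k‖) bound
  exact ⟨hs, hs.tsum_le_of_sum_range_le bound⟩

lemma exists_roots (b c : ℝ) : ∃ z1 z2 : ℂ, z1 + z2 = -b ∧ z1 * z2 = c ∧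
    z1 ^ 2 + b * z1 + c = 0 ∧ z2 ^ 2 + b * z2 + c = 0 := by
  obtain ⟨s, hs⟩ := IsAlgClosed.exists_pow_nat_eq ((b : ℂ) ^ 2 - 4 * c) (n := 2) (by norm_num)
  refine ⟨(-b + s) / 2, (-b - s) / 2, ?_, ?_, ?_, ?_⟩
  · ring
  · linear_combination (-1 / 4) * hs
  · linear_combination (1 / 4) * hs
  · linear_combination (1 / 4) * hs

lemma second_order_bound (b c : ℝ) (hroots : ∀ z : ℂ, z ^ 2 + b * z + c = 0 → ‖z‖ < 1) :
    ∃ K : ℝ, 0 ≤ K ∧ ∀ e g : ℕ → ℝ, (∀ k, e (k + 2) + b * e (k + 1) + c * e k = g k) →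
      Summable (fun k => g k ^ 2) →
      Summable (fun k => e k ^ 2) ∧
      ∑' k, e k ^ 2 ≤ K * (e 0 ^ 2 + e 1 ^ 2 + ∑' k, g k ^ 2) := by
  obtain ⟨z1, z2, hs, hp, h1, h2⟩ := exists_roots b c
  have n1 := hroots z1 h1
  have n2 := hroots z2 h2
  set K1 := (1 / (1 - ‖z1‖)) ^ 2 with hK1
  set K2 := (1 / (1 - ‖z2‖)) ^ 2 with hK2
  have hK1' : 0 ≤ K1 := by positivity
  have hK2' : 0 ≤ K2 := by positivity
  refine ⟨K1 * (1 + 2 * K2), by positivity, ?_⟩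
  intro e g he hg
  set q : ℕ → ℂ := fun k => (e (k + 1) : ℂ) - z1 * e k with hq
  have nr : ∀ x : ℝ, ‖(x : ℂ)‖ ^ 2 = x ^ 2 := by
    intro x; rw [Complex.norm_real, Real.norm_eq_abs, sq_abs]
  have A := first_order_bound z2 n2 q (fun k => (g k : ℂ)) (by
    intro k
    have hk : ((e (k + 2) : ℂ)) + b * e (k + 1) + c * e k = g k := by exact_mod_cast he k
    simp only [hq]
    rw [← hk, ← hp]
    have : (b : ℂ) = -(z1 + z2) := by rw [hs]; ring
    rw [this]; ring) (by simpa only [nr] using hg)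
  have B := first_order_bound z1 n1 (fun k => (e k : ℂ)) q (by
    intro k; simp only [hq]; ring) A.1
  simp only [nr] at A B
  refine ⟨B.1, B.2.trans ?_⟩
  have q0 : ‖q 0‖ ^ 2 ≤ 2 * (e 0 ^ 2 + e 1 ^ 2) := by
    have : ‖q 0‖ ≤ |e 1| + |e 0| := by
      simp only [hq]
      refine (norm_sub_le _ _).trans ?_
      rw [norm_mul, Complex.norm_real, Complex.norm_real, Real.norm_eq_abs, Real.norm_eq_abs]
      have : ‖z1‖ * |e 0| ≤ 1 * |e 0| := by gcongr
      simp only [zero_add]; linarith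
    have := pow_le_pow_left₀ (norm_nonneg _) this 2
    nlinarith [sq_nonneg (|e 1| - |e 0|), sq_abs (e 0), sq_abs (e 1)]
  have hG0 : 0 ≤ ∑' k, g k ^ 2 := tsum_nonneg fun _ => by positivity
  rw [mul_assoc]
  apply mul_le_mul_of_nonneg_left _ hK1'
  have A2 := A.2
  have := mul_le_mul_of_nonneg_left q0 hK2'
  nlinarith [sq_nonneg (e 0), sq_nonneg (e 1), mul_nonneg hK2' hG0]

lemma abel_summable (h : ℝ) (hh : h ∈ Set.Ioo (0 : ℝ) 1) (X : ℕ → ℝ) (M : ℝ)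
    (hX : ∀ k, |X k| ≤ M) : Summable (fun k => h * (2 - h) * ((1 - h) ^ 2) ^ k * X k) ∧
    |∑' k, h * (2 - h) * ((1 - h) ^ 2) ^ k * X k| ≤ M := by
  obtain ⟨h0, h1⟩ := hh
  have hr0 : 0 ≤ (1 - h) ^ 2 := sq_nonneg _
  have hr1 : (1 - h) ^ 2 < 1 := by nlinarith
  have ha : 0 < h * (2 - h) := by nlinarith
  have H : HasSum (fun k => h * (2 - h) * ((1 - h) ^ 2) ^ k * M) M := by
    have := ((hasSum_geometric_of_lt_one hr0 hr1).mul_left (h * (2 - h))).mul_right M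
    have e : h * (2 - h) * (1 - (1 - h) ^ 2)⁻¹ * M = M := by
      have : 1 - (1 - h) ^ 2 = h * (2 - h) := by ring
      rw [this, mul_inv_cancel₀ ha.ne', one_mul]
    rwa [e] at this
  have hb : ∀ k, ‖h * (2 - h) * ((1 - h) ^ 2) ^ k * X k‖ ≤
      h * (2 - h) * ((1 - h) ^ 2) ^ k * M := by
    intro k
    rw [Real.norm_eq_abs, abs_mul, abs_of_nonneg (by positivity)]
    exact mul_le_mul_of_nonneg_left (hX k) (by positivity)
  refine ⟨Summable.of_norm_bounded H.summable hb, ?_⟩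
  have := tsum_of_norm_bounded H hb
  simpa using this

lemma abel_mean (X Y : ℕ → ℝ) (m M : ℝ) (hX : ∀ k, X k = m + (Y (k + 1) - Y k))
    (hY : ∀ k, |Y k| ≤ M) :
    Filter.Tendsto (fun h : ℝ => ∑' k, h * (2 - h) * ((1 - h) ^ 2) ^ k * X k)
      (nhdsWithin 0 (Set.Ioi (0 : ℝ))) (nhds m) := by
  have hM : 0 ≤ M := (abs_nonneg _).trans (hY 0)
  have key : ∀ h ∈ Set.Ioo (0 : ℝ) 1,
      |∑' k, h * (2 - h) * ((1 - h) ^ 2) ^ k * X k - m| ≤ h * (2 - h) * (2 * M) := by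
    intro h hh
    have SY := abel_summable h hh Y M hY
    have SY1 := abel_summable h hh (fun k => Y (k + 1)) M (fun k => hY _)
    have Sm := abel_summable h hh (fun _ => m) |m| (fun k => le_rfl)
    obtain ⟨h0, h1⟩ := hh
    have hr0 : 0 ≤ (1 - h) ^ 2 := sq_nonneg _
    have hr1 : (1 - h) ^ 2 < 1 := by nlinarith
    have ha : 0 < h * (2 - h) := by nlinarith
    have tm : ∑' k, h * (2 - h) * ((1 - h) ^ 2) ^ k * m = m := by
      rw [tsum_mul_right, tsum_mul_left, tsum_geometric_of_lt_one hr0 hr1]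
      have : 1 - (1 - h) ^ 2 = h * (2 - h) := by ring
      rw [this, mul_inv_cancel₀ ha.ne', one_mul]
    have e1 : ∑' k, h * (2 - h) * ((1 - h) ^ 2) ^ k * X k =
        m + (∑' k, h * (2 - h) * ((1 - h) ^ 2) ^ k * Y (k + 1) -
          ∑' k, h * (2 - h) * ((1 - h) ^ 2) ^ k * Y k) := by
      rw [← SY1.1.tsum_sub SY.1]
      nth_rw 1 [← tm]
      rw [← Sm.1.tsum_add (SY1.1.sub SY.1)]
      congr 1; ext k; rw [hX]; ring
    have e2 : ∑' k, h * (2 - h) * ((1 - h) ^ 2) ^ k * Y k = h * (2 - h) * Y 0 +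
        (1 - h) ^ 2 * ∑' k, h * (2 - h) * ((1 - h) ^ 2) ^ k * Y (k + 1) := by
      rw [SY.1.tsum_eq_zero_add, ← tsum_mul_left]
      congr 1
      · simp
      · congr 1; ext k; rw [pow_succ]; ring
    set T := ∑' k, h * (2 - h) * ((1 - h) ^ 2) ^ k * Y (k + 1)
    have e3 : ∑' k, h * (2 - h) * ((1 - h) ^ 2) ^ k * X k - m = h * (2 - h) * (T - Y 0) := by
      rw [e1, e2]; ring
    rw [e3, abs_mul, abs_of_pos ha]
    apply mul_le_mul_of_nonneg_left _ ha.le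
    have := abs_sub T (Y 0)
    linarith [SY1.2, hY 0]
  have hlim : Filter.Tendsto (fun h : ℝ => h * (2 - h) * (2 * M))
      (nhdsWithin 0 (Set.Ioi (0 : ℝ))) (nhds 0) := by
    have : Continuous (fun h : ℝ => h * (2 - h) * (2 * M)) := by fun_prop
    have := this.tendsto 0
    simp only [zero_mul] at this
    exact this.mono_left nhdsWithin_le_nhds
  rw [tendsto_iff_norm_sub_tendsto_zero]
  refine squeeze_zero' (Filter.Eventually.of_forall fun _ => norm_nonneg _) ?_ hlim
  filter_upwards [Ioo_mem_nhdsGT (zero_lt_one' ℝ)] with h hh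
  exact key h hh

lemma stable_coef (b c : ℝ) (hroots : ∀ z : ℂ, z ^ 2 + b * z + c = 0 → ‖z‖ < 1) :
    c < 1 ∧ 0 < 1 + b + c ∧ 0 < 1 - b + c := by
  have hreal : ∀ x : ℝ, x ^ 2 + b * x + c = 0 → |x| < 1 := by
    intro x hx
    have := hroots (x : ℂ) (by exact_mod_cast hx)
    rwa [Complex.norm_real, Real.norm_eq_abs] at this
  refine ⟨?_, ?_, ?_⟩
  · obtain ⟨z1, z2, hs, hp, h1, h2⟩ := exists_roots b c
    have n1 := hroots z1 h1
    have n2 := hroots z2 h2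
    have : ‖(c : ℂ)‖ < 1 := by
      rw [← hp, norm_mul]
      exact mul_lt_one_of_nonneg_of_lt_one_left (norm_nonneg _) n1 n2.le
    rw [Complex.norm_real, Real.norm_eq_abs] at this
    exact (abs_lt.mp this).2
  · by_contra hcon
    push Not at hcon
    have hD : (b + 2) ^ 2 ≤ b ^ 2 - 4 * c := by nlinarith
    have hD0 : 0 ≤ b ^ 2 - 4 * c := (sq_nonneg _).trans hD
    have hs : b + 2 ≤ Real.sqrt (b ^ 2 - 4 * c) := Real.le_sqrt_of_sq_le hD
    have := hreal ((-b + Real.sqrt (b ^ 2 - 4 * c)) / 2) (by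
      linear_combination (1 / 4) * Real.sq_sqrt hD0)
    have := (abs_lt.mp this).2
    linarith
  · by_contra hcon
    push Not at hcon
    have hD : (2 - b) ^ 2 ≤ b ^ 2 - 4 * c := by nlinarith
    have hD0 : 0 ≤ b ^ 2 - 4 * c := (sq_nonneg _).trans hD
    have hs : 2 - b ≤ Real.sqrt (b ^ 2 - 4 * c) := Real.le_sqrt_of_sq_le hD
    have := hreal ((-b - Real.sqrt (b ^ 2 - 4 * c)) / 2) (by
      linear_combination (1 / 4) * Real.sq_sqrt hD0)
    have := (abs_lt.mp this).1
    linarith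

set_option maxHeartbeats 1000000 in
lemma scalar_limit (b c α : ℝ) (hroots : ∀ z : ℂ, z ^ 2 + b * z + c = 0 → ‖z‖ < 1)
    (V C : ℕ → ℝ) (M : ℝ) (hM : ∀ k, |V k| ≤ M)
    (hV : ∀ k, V (k + 2) + b * V (k + 1) + c * V k = -α * C (k + 1))
    (s : ℝ → ℕ → ℝ) (hs0 : ∀ h ∈ Set.Ioo (0 : ℝ) 1, s h 0 = 0)
    (hs1 : ∀ h ∈ Set.Ioo (0 : ℝ) 1, s h 1 = -α * Real.sqrt (h * (2 - h)))
    (hs : ∀ h ∈ Set.Ioo (0 : ℝ) 1, ∀ k, s h (k + 2) + b * s h (k + 1) + c * s h k =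
      -α * (Real.sqrt (h * (2 - h)) * (1 - h) ^ (k + 1) * C (k + 1)))
    (l : ℝ) (hl : Filter.Tendsto (fun h : ℝ => ∑' k, h * (2 - h) * ((1 - h) ^ 2) ^ k * V k ^ 2)
      (nhdsWithin 0 (Set.Ioi (0 : ℝ))) (nhds l)) :
    (∀ h ∈ Set.Ioo (0 : ℝ) 1, Summable (fun k => s h k ^ 2)) ∧
    Filter.Tendsto (fun h : ℝ => ∑' k, s h k ^ 2)
      (nhdsWithin 0 (Set.Ioi (0 : ℝ))) (nhds l) := by
  obtain ⟨K, hK, HK⟩ := second_order_bound b c hroots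
  have hM0 : 0 ≤ M := (abs_nonneg _).trans (hM 0)
  have hV2 : ∀ k, |V k ^ 2| ≤ M ^ 2 := fun k => by
    rw [abs_pow]; exact pow_le_pow_left₀ (abs_nonneg _) (hM k) 2
  set N := M * (1 + |c|) with hN
  set P := K * (2 * M ^ 2 + 2 * (|α| + M) ^ 2 + N ^ 2) with hP
  have hP0 : 0 ≤ P := by positivity
  have main : ∀ h ∈ Set.Ioo (0 : ℝ) 1, Summable (fun k => s h k ^ 2) ∧
      |∑' k, s h k ^ 2 - ∑' k, h * (2 - h) * ((1 - h) ^ 2) ^ k * V k ^ 2| ≤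
        P * h + Real.sqrt h * M ^ 2 + P * Real.sqrt h := by
    intro h hh
    obtain ⟨h0, h1⟩ := id hh
    have ha0 : 0 ≤ h * (2 - h) := by nlinarith
    set a := Real.sqrt (h * (2 - h)) with ha
    have ha2 : a ^ 2 = h * (2 - h) := Real.sq_sqrt ha0
    have hale : a ^ 2 ≤ 2 * h := by rw [ha2]; nlinarith
    set v : ℕ → ℝ := fun k => a * (1 - h) ^ k * V k with hv
    have hvsq : ∀ k, v k ^ 2 = h * (2 - h) * ((1 - h) ^ 2) ^ k * V k ^ 2 := by
      intro k; simp only [hv]; rw [← ha2, ← pow_mul, mul_comm 2 k, pow_mul]; ring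
    have SV := abel_summable h hh (fun k => V k ^ 2) (M ^ 2) hV2
    simp only [← hvsq] at SV ⊢
    set e : ℕ → ℝ := fun k => s h k - v k with he
    set g : ℕ → ℝ := fun k => h * (a * (1 - h) ^ k * ((1 - h) * V (k + 2) - c * V k)) with hg
    have hrec : ∀ k, e (k + 2) + b * e (k + 1) + c * e k = g k := by
      intro k
      have i1 := hs h hh k
      have i2 := hV k
      simp only [he, hv, hg]
      rw [pow_succ] at i1
      rw [pow_succ, pow_succ]
      linear_combination i1 - a * (1 - h) ^ k * (1 - h) * i2
    have hVN : ∀ k, |((1 - h) * V (k + 2) - c * V k) ^ 2| ≤ N ^ 2 := by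
      intro k
      rw [abs_pow]
      refine pow_le_pow_left₀ (abs_nonneg _) ?_ 2
      refine (abs_sub _ _).trans ?_
      rw [abs_mul, abs_mul, abs_of_pos (by linarith : 0 < 1 - h)]
      have j1 : (1 - h) * |V (k + 2)| ≤ 1 * M :=
        mul_le_mul (by linarith) (hM _) (abs_nonneg _) zero_le_one
      have j2 : |c| * |V k| ≤ |c| * M := mul_le_mul_of_nonneg_left (hM _) (abs_nonneg _)
      rw [hN]; linarith
    have SG := abel_summable h hh (fun k => ((1 - h) * V (k + 2) - c * V k) ^ 2) (N ^ 2) hVN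
    have hgsq : ∀ k, g k ^ 2 = h ^ 2 * (h * (2 - h) * ((1 - h) ^ 2) ^ k *
        ((1 - h) * V (k + 2) - c * V k) ^ 2) := by
      intro k; simp only [hg]; rw [← ha2, ← pow_mul, mul_comm 2 k, pow_mul]; ring
    have Sg : Summable (fun k => g k ^ 2) := by
      simp only [hgsq]; exact SG.1.mul_left _
    have Tg : ∑' k, g k ^ 2 ≤ h * N ^ 2 := by
      simp only [hgsq]
      rw [tsum_mul_left]
      have := (abs_le.mp SG.2).2
      calc _ ≤ h ^ 2 * N ^ 2 := mul_le_mul_of_nonneg_left this (by positivity)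
        _ ≤ h * N ^ 2 := mul_le_mul_of_nonneg_right (by nlinarith) (by positivity)
    obtain ⟨Se, Te⟩ := HK e g hrec Sg
    have E0 : e 0 ^ 2 ≤ 2 * h * M ^ 2 := by
      have : e 0 ^ 2 = a ^ 2 * V 0 ^ 2 := by simp only [he, hv, hs0 h hh]; ring
      rw [this]
      exact mul_le_mul hale ((le_abs_self _).trans (hV2 0)) (sq_nonneg _) (by positivity)
    have E1 : e 1 ^ 2 ≤ 2 * h * (|α| + M) ^ 2 := by
      have : e 1 ^ 2 = a ^ 2 * (α + (1 - h) * V 1) ^ 2 := by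
        simp only [he, hv, hs1 h hh]; ring
      rw [this]
      refine mul_le_mul hale ?_ (sq_nonneg _) (by positivity)
      rw [← sq_abs]
      refine pow_le_pow_left₀ (abs_nonneg _) ?_ 2
      refine (abs_add_le _ _).trans ?_
      rw [abs_mul, abs_of_pos (by linarith : 0 < 1 - h)]
      have j1 : (1 - h) * |V 1| ≤ 1 * M :=
        mul_le_mul (by linarith) (hM _) (abs_nonneg _) zero_le_one
      linarith
    have Te' : ∑' k, e k ^ 2 ≤ P * h := by
      refine Te.trans ?_
      rw [hP, mul_assoc]
      apply mul_le_mul_of_nonneg_left _ hK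
      linarith
    have hsh : 0 < Real.sqrt h := Real.sqrt_pos.mpr h0
    have hshsq : Real.sqrt h * Real.sqrt h = h := Real.mul_self_sqrt h0.le
    set t := Real.sqrt h with ht
    have Sdom : Summable (fun k => e k ^ 2 + t * v k ^ 2 + e k ^ 2 / t) :=
      (Se.add (SV.1.mul_left t)).add (Se.div_const t)
    have dom : ∀ k, ‖s h k ^ 2 - v k ^ 2‖ ≤ e k ^ 2 + t * v k ^ 2 + e k ^ 2 / t := by
      intro k
      have : s h k = e k + v k := by simp only [he]; ring
      rw [this, Real.norm_eq_abs]
      have x1 : t * v k ^ 2 + e k ^ 2 / t - 2 * (e k * v k) = (t * v k - e k) ^ 2 / t := by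
        field_simp; ring
      have x2 : t * v k ^ 2 + e k ^ 2 / t + 2 * (e k * v k) = (t * v k + e k) ^ 2 / t := by
        field_simp; ring
      have y1 : 0 ≤ (t * v k - e k) ^ 2 / t := by positivity
      have y2 : 0 ≤ (t * v k + e k) ^ 2 / t := by positivity
      rw [abs_le]
      have y3 := sq_nonneg (e k)
      have y4 : (e k + v k) ^ 2 - v k ^ 2 = e k ^ 2 + 2 * (e k * v k) := by ring
      rw [y4]
      constructor <;> linarith
    have Sdiff : Summable (fun k => s h k ^ 2 - v k ^ 2) := Summable.of_norm_bounded Sdom dom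
    have Ss : Summable (fun k => s h k ^ 2) := by
      have := Sdiff.add SV.1
      simpa using this
    refine ⟨Ss, ?_⟩
    rw [← Ss.tsum_sub SV.1]
    have Z := tsum_of_norm_bounded Sdom.hasSum dom
    rw [Real.norm_eq_abs] at Z
    refine Z.trans ?_
    rw [(Se.add (SV.1.mul_left t)).tsum_add (Se.div_const t), Se.tsum_add (SV.1.mul_left t),
      tsum_mul_left, tsum_div_const]
    have z1 : t * ∑' k, v k ^ 2 ≤ t * M ^ 2 :=
      mul_le_mul_of_nonneg_left ((le_abs_self _).trans SV.2) hsh.le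
    have z2 : (∑' k, e k ^ 2) / t ≤ P * t := by
      rw [div_le_iff₀ hsh, mul_assoc, hshsq]; exact Te'
    linarith
  refine ⟨fun h hh => (main h hh).1, ?_⟩
  have hlim : Filter.Tendsto (fun h : ℝ => P * h + Real.sqrt h * M ^ 2 + P * Real.sqrt h)
      (nhdsWithin 0 (Set.Ioi (0 : ℝ))) (nhds 0) := by
    have : Continuous (fun h : ℝ => P * h + Real.sqrt h * M ^ 2 + P * Real.sqrt h) := by fun_prop
    have := this.tendsto 0
    simp only [Real.sqrt_zero, zero_mul, mul_zero, add_zero] at this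
    exact this.mono_left nhdsWithin_le_nhds
  have hdiff : Filter.Tendsto (fun h : ℝ => ∑' k, s h k ^ 2 -
      ∑' k, h * (2 - h) * ((1 - h) ^ 2) ^ k * V k ^ 2)
      (nhdsWithin 0 (Set.Ioi (0 : ℝ))) (nhds 0) := by
    rw [tendsto_zero_iff_norm_tendsto_zero]
    refine squeeze_zero' (Filter.Eventually.of_forall fun _ => norm_nonneg _) ?_ hlim
    filter_upwards [Ioo_mem_nhdsGT (zero_lt_one' ℝ)] with h hh
    exact (main h hh).2
  have := hdiff.add hl
  simpa using this

/-- Squared gain denominators. -/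
lemma omega_spec (α β ν lam : ℝ) (hc : cCoef α β ν lam < 1)
    (hp : 0 < 1 + bCoef α β ν lam + cCoef α β ν lam)
    (hm : 0 < 1 - bCoef α β ν lam + cCoef α β ν lam) :
    0 ≤ rCoef α β ν lam ∧
    rCoef α β ν lam ^ 2 =
      ((1 + cCoef α β ν lam) * Real.cos (omegaStar α β ν lam) + bCoef α β ν lam) ^ 2 +
      ((1 - cCoef α β ν lam) * Real.sin (omegaStar α β ν lam)) ^ 2 ∧
    0 < rCoef α β ν lam ^ 2 := by
  unfold rCoef omegaStar
  generalize bCoef α β ν lam = b at *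
  generalize cCoef α β ν lam = c at *
  have h1c : 0 < 1 + c := by linarith
  have hab : |b * (1 + c)| = |b| * (1 + c) := by rw [abs_mul, abs_of_pos h1c]
  have hblt : |b| < 1 + c := abs_lt.mpr ⟨by linarith, by linarith⟩
  by_cases H : 0 < c ∧ |b * (1 + c)| < 4 * |c|
  · have Hr : 0 < c ∧ |b| * (1 + c) / (4 * c) < 1 := by
      refine ⟨H.1, ?_⟩
      rw [div_lt_one (by linarith [H.1]), ← hab]
      have := H.2
      rwa [abs_of_pos H.1] at this
    rw [if_pos H, if_pos Hr]
    obtain ⟨c0, hb⟩ := H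
    rw [abs_of_pos c0] at hb
    have hb2 := abs_lt.mp hb
    have hsq : (b * (1 + c)) ^ 2 < (4 * c) ^ 2 := sq_lt_sq' (by linarith) (by linarith)
    have hb4 : b ^ 2 < 4 * c := by nlinarith [mul_nonneg (sq_nonneg b) (sq_nonneg (1 - c))]
    have hpos : 0 < 1 - b ^ 2 / (4 * c) := by
      rw [sub_pos, div_lt_one (by linarith)]; exact hb4
    have hcos : Real.cos (Real.arccos (-(b * (1 + c)) / (4 * c))) = -(b * (1 + c)) / (4 * c) := by
      apply Real.cos_arccos
      · rw [le_div_iff₀ (by linarith)]; linarith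
      · rw [div_le_iff₀ (by linarith)]; linarith
    have hr2 : (|1 - c| * Real.sqrt (1 - b ^ 2 / (4 * c))) ^ 2 =
        (1 - c) ^ 2 * (1 - b ^ 2 / (4 * c)) := by
      rw [mul_pow, sq_abs, Real.sq_sqrt hpos.le]
    refine ⟨by positivity, ?_, ?_⟩
    · rw [hr2, mul_pow (1 - c), Real.sin_sq, hcos]
      field_simp; ring
    · rw [hr2]
      have : 0 < 1 - c := by linarith
      positivity
  · have Hr : ¬ (0 < c ∧ |b| * (1 + c) / (4 * c) < 1) := by
      rintro ⟨c0, h2⟩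
      apply H
      refine ⟨c0, ?_⟩
      rw [div_lt_one (by linarith)] at h2
      rw [hab, abs_of_pos c0]; exact h2
    rw [if_neg H, if_neg Hr]
    have habs : |(|1 + c| - |b|)| = 1 + c - |b| := by
      rw [abs_of_pos h1c, abs_of_pos]; linarith
    rw [habs]
    have H' : c ≤ 0 ∨ 4 * |c| ≤ |b * (1 + c)| := by
      by_contra hcon
      push Not at hcon
      exact H hcon
    refine ⟨by linarith, ?_, by have : 0 < 1 + c - |b| := by linarith
                                positivity⟩
    by_cases H2 : (1 - b + c) ^ 2 ≤ (1 + b + c) ^ 2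
    · rw [if_pos ⟨H', H2⟩, Real.cos_pi, Real.sin_pi]
      have : 0 ≤ b := by nlinarith
      rw [abs_of_nonneg this]; ring
    · rw [if_neg (fun h => H2 h.2), Real.cos_zero, Real.sin_zero]
      have : b ≤ 0 := by nlinarith
      rw [abs_of_nonpos this]; ring

lemma cos_sq_sin_zero (ω : ℝ) (h : Real.sin ω = 0) (k : ℕ) :
    Real.sin (ω * k) = 0 ∧ Real.cos (ω * k) ^ 2 = 1 := by
  have : Real.sin (ω * k) = 0 := by
    obtain ⟨n, hn⟩ := Real.sin_eq_zero_iff.mp h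
    rw [Real.sin_eq_zero_iff]
    exact ⟨n * k, by push_cast; rw [← hn]; ring⟩
  refine ⟨this, ?_⟩
  have := Real.sin_sq_add_cos_sq (ω * k)
  simp_all

lemma mean_trig (A B ω : ℝ) (hω : Real.sin ω ≠ 0) :
    Filter.Tendsto (fun h : ℝ => ∑' k : ℕ, h * (2 - h) * ((1 - h) ^ 2) ^ k *
      (A * Real.cos (ω * k) + B * Real.sin (ω * k)) ^ 2)
      (nhdsWithin 0 (Set.Ioi (0 : ℝ))) (nhds ((A ^ 2 + B ^ 2) / 2)) := by
  refine abel_mean _ (fun k => ((A ^ 2 - B ^ 2) / 2 * Real.sin (2 * (ω * k) - ω) -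
    A * B * Real.cos (2 * (ω * k) - ω)) / (2 * Real.sin ω)) _
    ((|(A ^ 2 - B ^ 2) / 2| + |A * B|) / |2 * Real.sin ω|) ?_ ?_
  · intro k
    have e : 2 * (ω * ((k + 1 : ℕ) : ℝ)) - ω = 2 * (ω * k) + ω := by push_cast; ring
    simp only [e]
    rw [Real.sin_add, Real.sin_sub, Real.cos_add, Real.cos_sub, Real.sin_two_mul,
      Real.cos_two_mul']
    have h1 := Real.sin_sq_add_cos_sq (ω * k)
    field_simp
    linear_combination (2 * (A ^ 2 + B ^ 2) * Real.sin ω) * h1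
  · intro k
    rw [abs_div]
    apply div_le_div_of_nonneg_right _ (abs_nonneg _)
    refine (abs_sub _ _).trans ?_
    rw [abs_mul _ (Real.sin _), abs_mul _ (Real.cos _)]
    have h1 := mul_le_mul_of_nonneg_left (Real.abs_sin_le_one (2 * (ω * k) - ω))
      (abs_nonneg ((A ^ 2 - B ^ 2) / 2))
    have h2 := mul_le_mul_of_nonneg_left (Real.abs_cos_le_one (2 * (ω * k) - ω))
      (abs_nonneg (A * B))
    linarith

lemma mean_const (m : ℝ) :
    Filter.Tendsto (fun h : ℝ => ∑' k : ℕ, h * (2 - h) * ((1 - h) ^ 2) ^ k * m)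
      (nhdsWithin 0 (Set.Ioi (0 : ℝ))) (nhds m) :=
  abel_mean (fun _ => m) (fun _ => 0) m 0 (by simp) (by simp)

/-- Combined scalar statement. -/
lemma scalar_main (b c α ω R : ℝ) (hroots : ∀ z : ℂ, z ^ 2 + b * z + c = 0 → ‖z‖ < 1)
    (hR : R = ((1 + c) * Real.cos ω + b) ^ 2 + ((1 - c) * Real.sin ω) ^ 2) (hR0 : 0 < R)
    (s : ℝ → ℕ → ℝ) (hs0 : ∀ h ∈ Set.Ioo (0 : ℝ) 1, s h 0 = 0)
    (hs1 : ∀ h ∈ Set.Ioo (0 : ℝ) 1, s h 1 = -α * Real.sqrt (h * (2 - h)))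
    (hs : ∀ h ∈ Set.Ioo (0 : ℝ) 1, ∀ k : ℕ, s h (k + 2) + b * s h (k + 1) + c * s h k =
      -α * (Real.sqrt (h * (2 - h)) * (1 - h) ^ (k + 1) * Real.cos (ω * (k + 1 : ℕ)))) :
    (∀ h ∈ Set.Ioo (0 : ℝ) 1, Summable (fun k => s h k ^ 2)) ∧
    ∃ l : ℝ, 0 < l ∧
      Filter.Tendsto (fun h : ℝ => ∑' k : ℕ, h * (2 - h) * ((1 - h) ^ 2) ^ k *
        Real.cos (ω * k) ^ 2) (nhdsWithin 0 (Set.Ioi (0 : ℝ))) (nhds l) ∧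
      Filter.Tendsto (fun h : ℝ => ∑' k, s h k ^ 2)
        (nhdsWithin 0 (Set.Ioi (0 : ℝ))) (nhds (l * (α ^ 2 / R))) := by
  set X := (1 + c) * Real.cos ω + b with hX
  set Y := (1 - c) * Real.sin ω with hY
  set A := -α * X / R with hA
  set B := -α * Y / R with hB
  have hAB : A ^ 2 + B ^ 2 = α ^ 2 / R := by
    rw [hA, hB]; field_simp; rw [hR]
  have h1 : A * X + B * Y = -α := by
    rw [hA, hB]; field_simp; rw [hR]; ring
  have h2 : B * X - A * Y = 0 := by
    rw [hA, hB]; ring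
  set V : ℕ → ℝ := fun k => A * Real.cos (ω * k) + B * Real.sin (ω * k) with hVdef
  have hM : ∀ k, |V k| ≤ |A| + |B| := by
    intro k
    refine (abs_add_le _ _).trans ?_
    rw [abs_mul, abs_mul]
    have h1 := mul_le_mul_of_nonneg_left (Real.abs_cos_le_one (ω * k)) (abs_nonneg A)
    have h2 := mul_le_mul_of_nonneg_left (Real.abs_sin_le_one (ω * k)) (abs_nonneg B)
    linarith
  have hV : ∀ k, V (k + 2) + b * V (k + 1) + c * V k = -α * Real.cos (ω * (k + 1 : ℕ)) := by
    intro k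
    simp only [hVdef]
    have e1 : ω * ((k + 2 : ℕ) : ℝ) = ω * (k + 1 : ℕ) + ω := by push_cast; ring
    have e2 : ω * (k : ℝ) = ω * (k + 1 : ℕ) - ω := by push_cast; ring
    rw [e1, e2, Real.cos_add, Real.sin_add, Real.cos_sub, Real.sin_sub]
    rw [hX, hY] at h1 h2
    linear_combination Real.cos (ω * (k + 1 : ℕ)) * h1 + Real.sin (ω * (k + 1 : ℕ)) * h2
  have key : ∃ l : ℝ, 0 < l ∧
      Filter.Tendsto (fun h : ℝ => ∑' k : ℕ, h * (2 - h) * ((1 - h) ^ 2) ^ k *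
        Real.cos (ω * k) ^ 2) (nhdsWithin 0 (Set.Ioi (0 : ℝ))) (nhds l) ∧
      Filter.Tendsto (fun h : ℝ => ∑' k : ℕ, h * (2 - h) * ((1 - h) ^ 2) ^ k * V k ^ 2)
        (nhdsWithin 0 (Set.Ioi (0 : ℝ))) (nhds (l * (α ^ 2 / R))) := by
    by_cases hω : Real.sin ω = 0
    · refine ⟨1, one_pos, ?_, ?_⟩
      · simp only [(cos_sq_sin_zero ω hω _).2]; exact mean_const 1
      · have hB0 : B = 0 := by rw [hB, hY, hω]; simp
        have : ∀ k, V k ^ 2 = 1 * (α ^ 2 / R) := by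
          intro k
          simp only [hVdef]
          rw [(cos_sq_sin_zero ω hω k).1, ← hAB, hB0]
          linear_combination A ^ 2 * (cos_sq_sin_zero ω hω k).2
        simp only [this]; exact mean_const _
    · refine ⟨1 / 2, by norm_num, ?_, ?_⟩
      · simpa using mean_trig 1 0 ω hω
      · rw [← hAB]
        have := mean_trig A B ω hω
        convert this using 2; ring
  obtain ⟨l, l0, l1, l2⟩ := key
  have Z := scalar_limit b c α hroots V (fun k => Real.cos (ω * k)) _ hM hV s hs0 hs1 hs _ l2
  exact ⟨Z.1, l, l0, l1, Z.2⟩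

lemma roots_of_spectralRadius {d : ℕ} (α β ν lam : ℝ) (Q : Matrix (Fin d) (Fin d) ℝ)
    (hρ : spectralRadius ℂ ((AQmat α β ν Q).map (algebraMap ℝ ℂ)) < 1)
    (u : Fin d → ℝ) (hu : Q.mulVec u = lam • u) (hu0 : u ≠ 0) (z : ℂ)
    (hz : z ^ 2 + (bCoef α β ν lam : ℝ) * z + (cCoef α β ν lam : ℝ) = 0) : ‖z‖ < 1 := by
  have hmem : z ∈ spectrum ℂ ((AQmat α β ν Q).map (algebraMap ℝ ℂ)) := by
    rw [spectrum.mem_iff, Matrix.isUnit_iff_isUnit_det, isUnit_iff_ne_zero, not_not,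
      ← Matrix.exists_mulVec_eq_zero_iff]
    set uc : Fin d → ℂ := fun i => (u i : ℂ) with huc
    have hQ : (Q.map (algebraMap ℝ ℂ)) *ᵥ uc = (lam : ℂ) • uc := by
      ext i
      have := RingHom.map_mulVec (algebraMap ℝ ℂ) Q u i
      rw [hu] at this
      have h2 : (algebraMap ℝ ℂ) ∘ u = uc := rfl
      rw [h2] at this
      rw [← this]
      simp [huc]
    refine ⟨Sum.elim (z • uc) uc, ?_, ?_⟩
    · intro h
      apply hu0
      ext i
      have := congrFun h (Sum.inr i)
      simpa [huc] using this
    · have m1 : (((1 + β) • (1 : Matrix (Fin d) (Fin d) ℝ) - (α * (1 + ν)) • Q).map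
          (algebraMap ℝ ℂ)) = (1 + β : ℂ) • (1 : Matrix (Fin d) (Fin d) ℂ) -
            (α * (1 + ν) : ℂ) • Q.map (algebraMap ℝ ℂ) := by
        ext i j; by_cases hij : i = j <;> simp [Matrix.one_apply, hij]
      have m2 : (((-β) • (1 : Matrix (Fin d) (Fin d) ℝ) + (α * ν) • Q).map
          (algebraMap ℝ ℂ)) = (-β : ℂ) • (1 : Matrix (Fin d) (Fin d) ℂ) +
            (α * ν : ℂ) • Q.map (algebraMap ℝ ℂ) := by
        ext i j; by_cases hij : i = j <;> simp [Matrix.one_apply, hij]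
      have m3 : ((1 : Matrix (Fin d) (Fin d) ℝ).map (algebraMap ℝ ℂ)) = 1 := by
        ext i j; by_cases hij : i = j <;> simp [Matrix.one_apply, hij]
      have m4 : ((0 : Matrix (Fin d) (Fin d) ℝ).map (algebraMap ℝ ℂ)) = 0 := by
        ext i j; simp
      have hc1 : (Sum.elim (z • uc) uc) ∘ Sum.inl = z • uc := rfl
      have hc2 : (Sum.elim (z • uc) uc) ∘ Sum.inr = uc := rfl
      rw [Matrix.sub_mulVec, AQmat, Matrix.fromBlocks_map, m1, m2, m3, m4,
        Matrix.fromBlocks_mulVec, hc1, hc2, Algebra.algebraMap_eq_smul_one,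
        Matrix.smul_mulVec, Matrix.one_mulVec, Matrix.sub_mulVec, Matrix.add_mulVec]
      simp only [Matrix.smul_mulVec, Matrix.one_mulVec, Matrix.mulVec_smul, hQ,
        Matrix.zero_mulVec]
      unfold bCoef cCoef at hz
      push_cast at hz
      ext i
      rcases i with i | i
      · simp only [Pi.sub_apply, Pi.smul_apply, Sum.elim_inl, Pi.add_apply, smul_eq_mul,
          Pi.zero_apply]
        linear_combination uc i * hz
      · simp
  have hle : (‖z‖₊ : ENNReal) ≤ spectralRadius ℂ ((AQmat α β ν Q).map (algebraMap ℝ ℂ)) :=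
    le_iSup₂ (f := fun (k : ℂ)
      (_ : k ∈ spectrum ℂ ((AQmat α β ν Q).map (algebraMap ℝ ℂ))) => (‖k‖₊ : ENNReal)) z hmem
  have := hle.trans_lt hρ
  exact_mod_cast this

/-- the explicit noise sequence `w_k^{(h)}` is almost worst-case for GMM on a
strongly convex quadratic: for each `h ∈ (0,1)` the noise and suboptimality sums are finite,
the noise sum is positive, and the ratio of square roots tends to the H∞ norm as `h → 0⁺`. -/
theorem almost_worst_case_noise (d : ℕ) (hd : 1 ≤ d) (μ L : ℝ) (hμ : 0 < μ) (hμL : μ < L)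
    (Q : Matrix (Fin d) (Fin d) ℝ) (hsymm : Q.IsSymm) (hpos : Q.PosDef)
    (hμspec : μ ∈ spectrum ℝ Q) (hLspec : L ∈ spectrum ℝ Q)
    (hbounds : ∀ t ∈ spectrum ℝ Q, μ ≤ t ∧ t ≤ L)
    (p : Fin d → ℝ) (r : ℝ)
    (f : (Fin d → ℝ) → ℝ)
    (hf : ∀ v, f v = (1 / 2) * (v ⬝ᵥ Q.mulVec v) + p ⬝ᵥ v + r)
    (xstar : Fin d → ℝ) (hxstar : xstar = -(Q⁻¹.mulVec p))
    (α β ν : ℝ) (hα : 0 < α) (hβ : 0 ≤ β) (hν : 0 ≤ ν)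
    (hρ : spectralRadius ℂ ((AQmat α β ν Q).map (algebraMap ℝ ℂ)) < 1)
    (lamstar : ℝ) (hlamstar : lamstar = μ ∨ lamstar = L)
    (hlammax : Real.sqrt lamstar / rCoef α β ν lamstar =
      max (Real.sqrt μ / rCoef α β ν μ) (Real.sqrt L / rCoef α β ν L))
    (ustar : Fin d → ℝ) (hu : Q.mulVec ustar = lamstar • ustar)
    (hunorm : ∑ i, ustar i ^ 2 = 1)
    (w : ℝ → ℕ → Fin d → ℝ)
    (hw : ∀ h ∈ Set.Ioo (0 : ℝ) 1, ∀ k : ℕ,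
      w h k = (Real.sqrt (h * (2 - h)) * (1 - h) ^ k *
        Real.cos (omegaStar α β ν lamstar * k)) • ustar)
    (x : ℝ → ℕ → Fin d → ℝ)
    (hx0 : ∀ h ∈ Set.Ioo (0 : ℝ) 1, x h 0 = xstar)
    (hrec : ∀ h ∈ Set.Ioo (0 : ℝ) 1, ∀ k : ℕ,
      x h (k + 1) = x h k
        - α • (Q.mulVec (x h k + ν • (x h k - x h (k - 1))) + p + w h k)
        + β • (x h k - x h (k - 1))) :
    (∀ h ∈ Set.Ioo (0 : ℝ) 1,
      Summable (fun k : ℕ => ∑ i, w h k i ^ 2) ∧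
      0 < ∑' k : ℕ, ∑ i, w h k i ^ 2 ∧
      Summable (fun k : ℕ => f (x h k) - f xstar)) ∧
    Filter.Tendsto
      (fun h : ℝ => Real.sqrt (∑' k : ℕ, (f (x h k) - f xstar)) /
        Real.sqrt (∑' k : ℕ, ∑ i, w h k i ^ 2))
      (nhdsWithin 0 (Set.Ioi (0 : ℝ)))
      (nhds (α / Real.sqrt 2 *
        max (Real.sqrt μ / rCoef α β ν μ) (Real.sqrt L / rCoef α β ν L))) := by
  have hlampos : 0 < lamstar := by
    rcases hlamstar with h | h <;> rw [h] <;> linarith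
  have huu : ustar ⬝ᵥ ustar = 1 := by
    rw [← hunorm]; simp only [dotProduct, sq]
  have hu0 : ustar ≠ 0 := by
    intro h; rw [h] at huu; simp at huu
  have hroots := roots_of_spectralRadius α β ν lamstar Q hρ ustar hu hu0
  obtain ⟨hc1, hp1, hm1⟩ := stable_coef _ _ hroots
  obtain ⟨hr0, hreq, hrpos⟩ := omega_spec α β ν lamstar hc1 hp1 hm1
  set ω := omegaStar α β ν lamstar with hω
  set b := bCoef α β ν lamstar with hb
  set c := cCoef α β ν lamstar with hc
  set R := rCoef α β ν lamstar with hR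
  rw [← hlammax]
  have hQx : Q.mulVec xstar = -p := by
    have hdet : IsUnit Q.det := isUnit_iff_ne_zero.mpr hpos.det_pos.ne'
    rw [hxstar, Matrix.mulVec_neg, Matrix.mulVec_mulVec, Matrix.mul_nonsing_inv _ hdet,
      Matrix.one_mulVec]
  have hfq : ∀ t : ℝ, f (xstar + t • ustar) - f xstar = lamstar / 2 * t ^ 2 := by
    intro t
    have hsym : xstar ⬝ᵥ ustar * lamstar = -(p ⬝ᵥ ustar) := by
      have h1 : xstar ⬝ᵥ Q.mulVec ustar = Q.mulVec xstar ⬝ᵥ ustar := by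
        rw [Matrix.dotProduct_mulVec, ← Matrix.mulVec_transpose, hsymm.eq]
      rw [hu, hQx, dotProduct_smul, neg_dotProduct, smul_eq_mul] at h1
      linarith
    rw [hf, hf, Matrix.mulVec_add, Matrix.mulVec_smul, hu, hQx]
    simp only [dotProduct_add, add_dotProduct, dotProduct_smul, smul_dotProduct, smul_eq_mul,
      dotProduct_neg, huu]
    rw [dotProduct_comm ustar p]
    linear_combination (1 / 2 * t) * hsym
  set s : ℝ → ℕ → ℝ := fun h k => ustar ⬝ᵥ (x h k - xstar) with hs
  have hex : ∀ h ∈ Set.Ioo (0 : ℝ) 1, ∀ k, (∃ t : ℝ, x h k = xstar + t • ustar) ∧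
      (∃ t : ℝ, x h (k - 1) = xstar + t • ustar) := by
    intro h hh k
    induction k with
    | zero =>
      refine ⟨⟨0, ?_⟩, ⟨0, ?_⟩⟩ <;> simp [hx0 h hh]
    | succ k ih =>
      obtain ⟨⟨t1, h1⟩, ⟨t2, h2⟩⟩ := ih
      refine ⟨⟨-b * t1 - c * t2 - α * (Real.sqrt (h * (2 - h)) * (1 - h) ^ k *
        Real.cos (ω * k)), ?_⟩, ⟨t1, h1⟩⟩
      rw [hrec h hh k, hw h hh k, h1, h2]
      simp only [Matrix.mulVec_add, Matrix.mulVec_smul, Matrix.mulVec_sub, hu, hQx]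
      ext i
      simp only [Pi.add_apply, Pi.sub_apply, Pi.smul_apply, smul_eq_mul, Pi.neg_apply, hb, hc,
        bCoef, cCoef]
      ring
  have hst : ∀ h k t, x h k = xstar + t • ustar → s h k = t := by
    intro h k t ht
    simp only [hs, ht, add_sub_cancel_left, dotProduct_smul, huu, smul_eq_mul, mul_one]
  have hxs : ∀ h ∈ Set.Ioo (0 : ℝ) 1, ∀ k, x h k = xstar + s h k • ustar := by
    intro h hh k
    obtain ⟨t, ht⟩ := (hex h hh k).1
    rw [hst h k t ht]; exact ht
  have hsrec : ∀ h ∈ Set.Ioo (0 : ℝ) 1, ∀ k, s h (k + 1) = -b * s h k - c * s h (k - 1) -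
      α * (Real.sqrt (h * (2 - h)) * (1 - h) ^ k * Real.cos (ω * k)) := by
    intro h hh k
    apply hst
    rw [hrec h hh k, hw h hh k, hxs h hh k, hxs h hh (k - 1)]
    simp only [Matrix.mulVec_add, Matrix.mulVec_smul, Matrix.mulVec_sub, hu, hQx]
    ext i
    simp only [Pi.add_apply, Pi.sub_apply, Pi.smul_apply, smul_eq_mul, Pi.neg_apply, hb, hc,
      bCoef, cCoef]
    ring
  have hs0 : ∀ h ∈ Set.Ioo (0 : ℝ) 1, s h 0 = 0 := by
    intro h hh; apply hst; simp [hx0 h hh]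
  obtain ⟨Ss, l, l0, lw, ls⟩ := scalar_main b c α ω (R ^ 2) hroots hreq hrpos s hs0 (by
      intro h hh
      have := hsrec h hh 0
      simp only [zero_add, Nat.zero_sub, hs0 h hh, Nat.cast_zero, mul_zero, Real.cos_zero,
        pow_zero] at this
      rw [this]; ring) (by
      intro h hh k
      have := hsrec h hh (k + 1)
      rw [Nat.add_sub_cancel] at this
      linear_combination this)
  have hfx : ∀ h ∈ Set.Ioo (0 : ℝ) 1, ∀ k, f (x h k) - f xstar = lamstar / 2 * s h k ^ 2 := by
    intro h hh k
    rw [hxs h hh k, hfq]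
  have hwx : ∀ h ∈ Set.Ioo (0 : ℝ) 1, ∀ k, ∑ i, w h k i ^ 2 =
      h * (2 - h) * ((1 - h) ^ 2) ^ k * Real.cos (ω * k) ^ 2 := by
    intro h hh k
    have ha : Real.sqrt (h * (2 - h)) ^ 2 = h * (2 - h) :=
      Real.sq_sqrt (by nlinarith [hh.1, hh.2])
    rw [hw h hh k]
    simp only [Pi.smul_apply, smul_eq_mul, mul_pow]
    rw [← Finset.mul_sum, hunorm, ha, ← pow_mul, ← pow_mul, mul_comm k 2, mul_one]
  have hWs : ∀ h ∈ Set.Ioo (0 : ℝ) 1, Summable (fun k : ℕ => ∑ i, w h k i ^ 2) := by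
    intro h hh
    simp only [hwx h hh]
    refine (abel_summable h hh _ 1 ?_).1
    intro k
    rw [abs_pow]
    exact pow_le_one₀ (abs_nonneg _) (Real.abs_cos_le_one _)
  refine ⟨?_, ?_⟩
  · intro h hh
    refine ⟨hWs h hh, ?_, ?_⟩
    · refine (hWs h hh).tsum_pos (fun k => Finset.sum_nonneg fun i _ => sq_nonneg _) 0 ?_
      rw [hwx h hh]
      simp only [pow_zero, Nat.cast_zero, mul_zero, Real.cos_zero]
      nlinarith [hh.1, hh.2]
    · simp only [hfx h hh]
      exact (Ss h hh).mul_left _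
  · have hlim := ((ls.const_mul (lamstar / 2)).sqrt).div lw.sqrt (Real.sqrt_pos.mpr l0).ne'
    have hval : Real.sqrt (lamstar / 2 * (l * (α ^ 2 / R ^ 2))) / Real.sqrt l =
        α / Real.sqrt 2 * (Real.sqrt lamstar / R) := by
      have e : lamstar / 2 * (l * (α ^ 2 / R ^ 2)) = (lamstar / 2) * (α / R) ^ 2 * l := by
        rw [div_pow]; ring
      have hl' := (Real.sqrt_pos.mpr l0).ne'
      rw [e, Real.sqrt_mul (by positivity), mul_div_assoc, div_self hl', mul_one,
        Real.sqrt_mul (by positivity), Real.sqrt_sq (by positivity),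
        Real.sqrt_div hlampos.le]
      ring
    rw [hval] at hlim
    refine hlim.congr' ?_
    filter_upwards [Ioo_mem_nhdsGT (zero_lt_one' ℝ)] with h hh
    simp only [hfx h hh, hwx h hh, tsum_mul_left, Pi.div_apply]
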